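/- Persistence of the coordinate and physical bounds (Lemma 14.1): Let x : [0,T]×Ω → ℝⁿ be smooth with invertible Jacobian and set M(t) = sup_{y∈Ω} √(|∂x/∂y|² + |∂y/∂x|²). If T · |||ẋ|||₁ · M(0) ≤ 1/8, where ẋ = D_t x and |||u|||₁ = sup_{0≤t≤T} ‖u(t,·)‖_{1,∞}, then M(t) ≤ 2M(0) for all 0 ≤ t ≤ T. Furthermore, let p : [0,T]×Ω → ℝ be smooth with p(t,·) = 0 on ∂Ω and ∇_N p ≠ 0 on ∂Ω, and set N(t) = sup_{y∈∂Ω} |∇_N p(t,y)|^{-1}. If in addition T · |||ṗ|||₁ · M(0) · N(0) ≤ 1/8, where ṗ = D_t p, then N(t) ≤ 2N(0) for all 0 ≤ t ≤ T. -/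

import Mathlib

open scoped BigOperators
open Set Matrix

noncomputable section

abbrev E' (n : ℕ) := EuclideanSpace ℝ (Fin n)

def Ball (n : ℕ) : Set (E' n) := Metric.closedBall 0 1

def Sphere' (n : ℕ) : Set (E' n) := Metric.sphere 0 1

variable {n : ℕ} {F : Type*} [NormedAddCommGroup F] [NormedSpace ℝ F]

/-- Partial derivative `∂u/∂y^a`. -/
def pd (a : Fin n) (u : E' n → ℝ) (y : E' n) : ℝ :=
  fderiv ℝ u y (EuclideanSpace.single a 1)

/-- Jacobian matrix `∂x^i/∂y^a`. -/
def jacM (x : E' n → E' n) (y : E' n) : Matrix (Fin n) (Fin n) ℝ :=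
  Matrix.of fun i a => pd a (fun z => x z i) y

/-- Metric `g_{ab} = Σ_i (∂x^i/∂y^a)(∂x^i/∂y^b)`. -/
def gMet (x : E' n → E' n) (y : E' n) : Matrix (Fin n) (Fin n) ℝ :=
  (jacM x y)ᵀ * jacM x y

def kappa (x : E' n → E' n) (y : E' n) : ℝ := (jacM x y).det

/-- Eulerian derivative `∂_i u = (∂y^a/∂x^i) ∂_a u`. -/
def epd (x : E' n → E' n) (i : Fin n) (u : E' n → ℝ) (y : E' n) : ℝ :=
  ∑ a, (jacM x y)⁻¹ a i * pd a u y

/-- Laplace–Beltrami operator `Δq = κ⁻¹ ∂_a (κ g^{ab} ∂_b q)`. -/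
def lapl (x : E' n → E' n) (q : E' n → ℝ) (y : E' n) : ℝ :=
  (kappa x y)⁻¹ *
    ∑ a, pd a (fun z => kappa x z * ∑ b, (gMet x z)⁻¹ a b * pd b q z) y

/-- Lagrangian divergence `div W = κ⁻¹ ∂_a (κ W^a)`. -/
def divL (x : E' n → E' n) (W : E' n → Fin n → ℝ) (y : E' n) : ℝ :=
  (kappa x y)⁻¹ * ∑ a, pd a (fun z => kappa x z * W z a) y

/-- Eulerian divergence `div u = ∂_k u^k`. -/
def divE (x : E' n → E' n) (u : E' n → Fin n → ℝ) (y : E' n) : ℝ :=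
  ∑ k, epd x k (fun z => u z k) y

/-- Eulerian curl `curl u_{ij} = ∂_i u_j − ∂_j u_i`. -/
def curlE (x : E' n → E' n) (u : E' n → Fin n → ℝ) (i j : Fin n) (y : E' n) : ℝ :=
  epd x i (fun z => u z j) y - epd x j (fun z => u z i) y

/-- Exterior unit (with respect to `g`) normal derivative on the unit sphere. -/
def gradN (x : E' n → E' n) (p : E' n → ℝ) (y : E' n) : ℝ :=
  (∑ a, ∑ b, (gMet x y)⁻¹ a b * y b * pd a p y) /
    Real.sqrt (∑ a, ∑ b, (gMet x y)⁻¹ a b * y a * y b)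

/-- Coordinate condition `|∂x/∂y|² + |∂y/∂x|² ≤ c₁²`. -/
def coordCond (x : E' n → E' n) (c₁ : ℝ) (y : E' n) : Prop :=
  (∑ i, ∑ a, (jacM x y i a) ^ 2) + (∑ i, ∑ a, ((jacM x y)⁻¹ i a) ^ 2) ≤ c₁ ^ 2

/-- Physical condition `∇_N p ≤ −c₀` on the boundary. -/
def physCond (x : E' n → E' n) (p : E' n → ℝ) (c₀ : ℝ) : Prop :=
  ∀ y ∈ Sphere' n, gradN x p y ≤ -c₀

/-- Material (time) derivative at fixed `y`. -/
def Dt (u : ℝ → E' n → F) : ℝ → E' n → F := fun t y => deriv (fun s => u s y) t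

/-- Iterated time derivative. -/
def Dts (k : ℕ) (u : ℝ → E' n → F) : ℝ → E' n → F := Dt^[k] u

/-- Joint space-time smoothness. -/
def SmoothST (u : ℝ → E' n → F) : Prop :=
  ContDiff ℝ (⊤ : ℕ∞) fun p : ℝ × E' n => u p.1 p.2

/-- `L²` Sobolev norm of order `r` on the unit ball. -/
def sobNorm (r : ℕ) (u : E' n → F) : ℝ :=
  ∑ j ∈ Finset.range (r + 1), (∫ y in Ball n, ‖iteratedFDeriv ℝ j u y‖ ^ 2) ^ ((1:ℝ)/2)

/-- `C^k` supremum norm on the unit ball. -/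
def ckNorm (k : ℕ) (u : E' n → F) : ℝ :=
  ∑ j ∈ Finset.range (k + 1), ⨆ y ∈ Ball n, ‖iteratedFDeriv ℝ j u y‖

/-- Hölder norm of order `a` on the set `s`. -/
def holderNormOn (s : Set (E' n)) (a : ℝ) (u : E' n → F) : ℝ :=
  if a ≤ 0 then ⨆ y ∈ s, ‖u y‖
  else
    (⨆ z ∈ s, ⨆ w ∈ s,
        ‖iteratedFDeriv ℝ (⌈a⌉₊ - 1) u z - iteratedFDeriv ℝ (⌈a⌉₊ - 1) u w‖ /
          ‖z - w‖ ^ (a - ((⌈a⌉₊ : ℝ) - 1))) +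
      ⨆ y ∈ s, ‖u y‖

/-- Hölder norm of order `a` on the unit ball. -/
def holderNorm (a : ℝ) (u : E' n → F) : ℝ := holderNormOn (Ball n) a u

/-- Space-time norm `|||u|||_{a,k}`. -/
def stNorm (T : ℝ) (a : ℝ) (k : ℕ) (u : ℝ → E' n → F) : ℝ :=
  ⨆ t ∈ Icc (0:ℝ) T, ∑ j ∈ Finset.range (k + 1), holderNorm a fun y => Dts j u t y

/-- The defining property of the pressure `p = Ψ(x)`:
`Δp = −(∂_i V^k)(∂_k V^i)` in `Ω`, `p = 0` on `∂Ω`. -/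
def IsPressure (x v : E' n → E' n) (p : E' n → ℝ) : Prop :=
  ContDiff ℝ (⊤ : ℕ∞) p ∧ (∀ y ∈ Sphere' n, p y = 0) ∧
    ∀ y ∈ Ball n,
      lapl x p y = -∑ i, ∑ k, epd x i (fun z => v z k) y * epd x k (fun z => v z i) y

/-- The pressure, selected by choice. -/
def pressureFn (x v : E' n → E' n) : E' n → ℝ := Classical.epsilon (IsPressure x v)

/-- The Euler map `Φ(x)_i = D_t² x_i + ∂_i p`. -/
def eulerMap (x : ℝ → E' n → E' n) : ℝ → E' n → Fin n → ℝ := fun t y i =>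
  Dts 2 x t y i + epd (x t) i (pressureFn (x t) (Dt x t)) y

/-- First variational derivative `Φ'(x)δx`. -/
def eulerMap' (x δx : ℝ → E' n → E' n) : ℝ → E' n → Fin n → ℝ := fun t y i =>
  deriv (fun r : ℝ => eulerMap (fun s z => x s z + r • δx s z) t y i) 0

/-- Second variational derivative `Φ''(x)(δx, εx)`. -/
def eulerMap'' (x δx εx : ℝ → E' n → E' n) : ℝ → E' n → Fin n → ℝ := fun t y i =>
  deriv (fun r : ℝ =>
    deriv (fun s : ℝ => eulerMap (fun τ z => x τ z + r • δx τ z + s • εx τ z) t y i) 0) 0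

/-- Modified linearized operator `L₁ δx = Φ'(x)δx − δx^k ∂_k Φ^i + δx^i div Φ`. -/
def modLin (x δx : ℝ → E' n → E' n) : ℝ → E' n → Fin n → ℝ := fun t y i =>
  eulerMap' x δx t y i
    - (∑ k, δx t y k * epd (x t) k (fun z => eulerMap x t z i) y)
    + δx t y i * ∑ k, epd (x t) k (fun z => eulerMap x t z k) y


/-- `M(t) = sup_{y∈Ω} √(|∂x/∂y|² + |∂y/∂x|²)`. -/
def Mfun (x : ℝ → E' n → E' n) (t : ℝ) : ℝ :=
  ⨆ y ∈ Ball n,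
    Real.sqrt ((∑ i, ∑ a, (jacM (x t) y i a) ^ 2) + ∑ i, ∑ a, ((jacM (x t) y)⁻¹ i a) ^ 2)

/-- `N(t) = sup_{y∈∂Ω} |∇_N p|⁻¹`. -/
def Nfun (x : ℝ → E' n → E' n) (p : ℝ → E' n → ℝ) (t : ℝ) : ℝ :=
  ⨆ y ∈ Sphere' n, |gradN (x t) (p t) y|⁻¹

lemma le_biSup_of_nonneg {α : Type*} {s : Set α} {f : α → ℝ} (hf : ∀ a, 0 ≤ f a)
    (hb : BddAbove (f '' s)) {a : α} (ha : a ∈ s) : f a ≤ ⨆ b ∈ s, f b := by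
  obtain ⟨C, hC⟩ := hb
  have hC' : ∀ b ∈ s, f b ≤ C := fun b hb => hC (mem_image_of_mem f hb)
  have hbdd : BddAbove (range fun b => ⨆ _ : b ∈ s, f b) := by
    refine ⟨C, ?_⟩
    rintro _ ⟨b, rfl⟩
    exact Real.iSup_le (hC' b) ((hf a).trans (hC' a ha))
  refine le_trans ?_ (le_ciSup hbdd a)
  simp [ha]

lemma biSup_le_of_nonneg {α : Type*} {s : Set α} {f : α → ℝ} {C : ℝ} (hC : 0 ≤ C)
    (h : ∀ a ∈ s, f a ≤ C) : ⨆ a ∈ s, f a ≤ C :=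
  Real.iSup_le (fun a => Real.iSup_le (h a) hC) hC

section MatrixBounds

open scoped Matrix.Norms.L2Operator

/-- The squared Frobenius norm. -/
def frobSq (A : Matrix (Fin n) (Fin n) ℝ) : ℝ := ∑ i, ∑ a, A i a ^ 2

lemma frobSq_nonneg (A : Matrix (Fin n) (Fin n) ℝ) : 0 ≤ frobSq A :=
  Finset.sum_nonneg fun _ _ => Finset.sum_nonneg fun _ _ => sq_nonneg _

lemma norm_mulVec_le (A : Matrix (Fin n) (Fin n) ℝ) (v : Fin n → ℝ) :
    ‖WithLp.toLp 2 (A *ᵥ v)‖ ≤ ‖A‖ * ‖WithLp.toLp 2 v‖ :=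
  A.l2_opNorm_mulVec (WithLp.toLp 2 v)

lemma norm_le_of_norm_mulVec_le (A : Matrix (Fin n) (Fin n) ℝ) {C : ℝ} (hC : 0 ≤ C)
    (h : ∀ v : E' n, ‖WithLp.toLp 2 (A *ᵥ v.ofLp)‖ ≤ C * ‖v‖) : ‖A‖ ≤ C := by
  rw [Matrix.l2_opNorm_def]
  exact ContinuousLinearMap.opNorm_le_bound _ hC h

lemma norm_transpose_eq (A : Matrix (Fin n) (Fin n) ℝ) : ‖Aᵀ‖ = ‖A‖ := by
  rw [← Matrix.l2_opNorm_conjTranspose A, Matrix.conjTranspose_eq_transpose_of_trivial]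

lemma sq_norm_toLp (v : Fin n → ℝ) : ‖WithLp.toLp 2 v‖ ^ 2 = ∑ i, v i ^ 2 := by
  simp [EuclideanSpace.norm_sq_eq]

lemma norm_sq_le_frobSq (A : Matrix (Fin n) (Fin n) ℝ) : ‖A‖ ^ 2 ≤ frobSq A := by
  have h : ‖A‖ ≤ √(frobSq A) := by
    refine norm_le_of_norm_mulVec_le A (Real.sqrt_nonneg _) fun v => ?_
    refine (abs_le_of_sq_le_sq' ?_ (by positivity)).2
    rw [mul_pow, Real.sq_sqrt (frobSq_nonneg A), sq_norm_toLp, EuclideanSpace.norm_sq_eq, frobSq,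
      Finset.sum_mul]
    refine Finset.sum_le_sum fun i _ => ?_
    simpa [Matrix.mulVec, dotProduct] using
      Finset.sum_mul_sq_le_sq_mul_sq Finset.univ (A i) v.ofLp
  calc ‖A‖ ^ 2 ≤ √(frobSq A) ^ 2 := by gcongr
    _ = frobSq A := Real.sq_sqrt (frobSq_nonneg A)

lemma frobSq_mul_le (A B : Matrix (Fin n) (Fin n) ℝ) :
    frobSq (A * B) ≤ ‖A‖ ^ 2 * frobSq B := by
  have hcol : ∀ C : Matrix (Fin n) (Fin n) ℝ,
      frobSq C = ∑ j, ‖WithLp.toLp 2 (C.col j)‖ ^ 2 := fun C => by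
    simp_rw [frobSq, sq_norm_toLp, Matrix.col_apply]
    exact Finset.sum_comm
  rw [hcol, hcol, Finset.mul_sum]
  refine Finset.sum_le_sum fun j _ => ?_
  rw [← mul_pow]
  gcongr
  exact norm_mulVec_le A (B.col j)

lemma frobSq_le_mul_norm_sq (A : Matrix (Fin n) (Fin n) ℝ) : frobSq A ≤ n * ‖A‖ ^ 2 := by
  have h := frobSq_mul_le A 1
  have h1 : frobSq (1 : Matrix (Fin n) (Fin n) ℝ) = n := by
    simp [frobSq, Matrix.one_apply]
  rw [mul_one, h1] at h
  linarith

lemma frobSq_add_le (A B : Matrix (Fin n) (Fin n) ℝ) :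
    frobSq (A + B) ≤ 2 * frobSq A + 2 * frobSq B := by
  simp only [frobSq, Finset.mul_sum, ← Finset.sum_add_distrib, Matrix.add_apply]
  refine Finset.sum_le_sum fun i _ => Finset.sum_le_sum fun j _ => ?_
  nlinarith [sq_nonneg (A i j - B i j)]

lemma two_mul_card_le_frobSq_add {A : Matrix (Fin n) (Fin n) ℝ} (hA : A.det ≠ 0) :
    2 * (n : ℝ) ≤ frobSq A + frobSq A⁻¹ := by
  have htr : ∑ i, ∑ a, A i a * A⁻¹ a i = n := by
    have h := congrArg Matrix.trace (Matrix.mul_nonsing_inv A hA.isUnit)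
    simpa [Matrix.trace, Matrix.mul_apply] using h
  have hinv : frobSq A⁻¹ = ∑ i, ∑ a, A⁻¹ a i ^ 2 := Finset.sum_comm
  rw [← htr, hinv]
  simp only [frobSq, Finset.mul_sum, ← Finset.sum_add_distrib]
  refine Finset.sum_le_sum fun i _ => Finset.sum_le_sum fun a _ => ?_
  nlinarith [sq_nonneg (A i a - A⁻¹ a i)]

lemma frobSq_add_inv_le {A B : Matrix (Fin n) (Fin n) ℝ} {M : ℝ} (hn : 2 ≤ n)
    (hA : A.det ≠ 0) (hB : B.det ≠ 0) (hM : 0 ≤ M)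
    (hAM : frobSq A + frobSq A⁻¹ ≤ M ^ 2) (hd : ‖B - A‖ * M ≤ 1 / 8) :
    frobSq B + frobSq B⁻¹ ≤ (2 * M) ^ 2 := by
  have hcard := two_mul_card_le_frobSq_add hA
  have hn' : (2 : ℝ) ≤ n := by exact_mod_cast hn
  have hfA := frobSq_nonneg A
  have hd2 : (‖B - A‖ * M) ^ 2 ≤ 1 / 64 := by
    have : 0 ≤ ‖B - A‖ * M := by positivity
    nlinarith
  have hB1 : frobSq B ≤ 2 * frobSq A + 1 / 64 := by
    have h := frobSq_add_le A (B - A)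
    rw [add_sub_cancel] at h
    have h2 := frobSq_le_mul_norm_sq (B - A)
    nlinarith [sq_nonneg ‖B - A‖]
  have hinv : B⁻¹ = A⁻¹ + (-(A⁻¹ * (B - A))) * B⁻¹ := by
    rw [mul_sub, Matrix.nonsing_inv_mul A hA.isUnit, neg_mul, sub_mul, mul_assoc,
      Matrix.mul_nonsing_inv B hB.isUnit]
    simp
  have hB2 : frobSq B⁻¹ ≤ 2 * frobSq A⁻¹ + 1 / 32 * frobSq B⁻¹ := by
    have h := frobSq_add_le A⁻¹ ((-(A⁻¹ * (B - A))) * B⁻¹)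
    rw [← hinv] at h
    have h2 := frobSq_mul_le (-(A⁻¹ * (B - A))) B⁻¹
    have h3 : ‖-(A⁻¹ * (B - A))‖ ^ 2 ≤ 1 / 64 := by
      have hinvM : ‖A⁻¹‖ ≤ M :=
        (abs_le_of_sq_le_sq' ((norm_sq_le_frobSq A⁻¹).trans (by linarith)) hM).2
      rw [norm_neg]
      calc ‖A⁻¹ * (B - A)‖ ^ 2 ≤ (M * ‖B - A‖) ^ 2 := by
            gcongr
            exact (norm_mul_le _ _).trans (by gcongr)
        _ ≤ 1 / 64 := by rwa [mul_comm]
    nlinarith [frobSq_nonneg B⁻¹]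
  nlinarith [frobSq_nonneg A⁻¹]

lemma norm_transpose_inv_mulVec_le {A B : Matrix (Fin n) (Fin n) ℝ} {M : ℝ}
    (hA : A.det ≠ 0) (hB : B.det ≠ 0) (hM : 0 ≤ M)
    (hAM : frobSq A + frobSq A⁻¹ ≤ M ^ 2) (hd : ‖B - A‖ * M ≤ 1 / 8) (v w : Fin n → ℝ) :
    ‖WithLp.toLp 2 (A⁻¹ᵀ *ᵥ v)‖ ≤
      9 / 8 * ‖WithLp.toLp 2 (B⁻¹ᵀ *ᵥ w)‖ + M * ‖WithLp.toLp 2 w - WithLp.toLp 2 v‖ := by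
  have hinvM : ‖A⁻¹‖ ≤ M :=
    (abs_le_of_sq_le_sq' ((norm_sq_le_frobSq A⁻¹).trans (by linarith [frobSq_nonneg A])) hM).2
  have hinv : A⁻¹ = B⁻¹ + B⁻¹ * ((B - A) * A⁻¹) := by
    rw [sub_mul, Matrix.mul_nonsing_inv A hA.isUnit, mul_sub, ← mul_assoc,
      Matrix.nonsing_inv_mul B hB.isUnit]
    simp
  have hw : A⁻¹ᵀ *ᵥ w = B⁻¹ᵀ *ᵥ w + ((B - A) * A⁻¹)ᵀ *ᵥ (B⁻¹ᵀ *ᵥ w) := by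
    conv_lhs => rw [hinv]
    rw [Matrix.transpose_add, Matrix.transpose_mul, Matrix.add_mulVec, Matrix.mulVec_mulVec]
  have hv : A⁻¹ᵀ *ᵥ v = A⁻¹ᵀ *ᵥ w - A⁻¹ᵀ *ᵥ (w - v) := by
    rw [Matrix.mulVec_sub]; abel
  have h1 : ‖WithLp.toLp 2 (A⁻¹ᵀ *ᵥ w)‖ ≤ 9 / 8 * ‖WithLp.toLp 2 (B⁻¹ᵀ *ᵥ w)‖ := by
    rw [hw, WithLp.toLp_add]
    have h := norm_mulVec_le ((B - A) * A⁻¹)ᵀ (B⁻¹ᵀ *ᵥ w)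
    rw [norm_transpose_eq] at h
    have h2 : ‖(B - A) * A⁻¹‖ ≤ 1 / 8 := (norm_mul_le _ _).trans (le_trans (by gcongr) hd)
    have h3 := norm_add_le (WithLp.toLp 2 (B⁻¹ᵀ *ᵥ w))
      (WithLp.toLp 2 (((B - A) * A⁻¹)ᵀ *ᵥ (B⁻¹ᵀ *ᵥ w)))
    nlinarith [norm_nonneg (WithLp.toLp 2 (B⁻¹ᵀ *ᵥ w))]
  have h2 : ‖WithLp.toLp 2 (A⁻¹ᵀ *ᵥ (w - v))‖ ≤
      M * ‖WithLp.toLp 2 w - WithLp.toLp 2 v‖ := by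
    have h := norm_mulVec_le A⁻¹ᵀ (w - v)
    rw [norm_transpose_eq] at h
    exact h.trans (by rw [WithLp.toLp_sub]; gcongr)
  rw [hv, WithLp.toLp_sub]
  exact (norm_sub_le _ _).trans (add_le_add h1 h2)

end MatrixBounds

section TimeDerivative

lemma SmoothST.fderiv_eq {u : ℝ → E' n → F} (hu : SmoothST u) (t : ℝ) (y : E' n) :
    fderiv ℝ (u t) y = (fderiv ℝ (fun p : ℝ × E' n => u p.1 p.2) (t, y)).comp
      (ContinuousLinearMap.inr ℝ ℝ (E' n)) :=
  HasFDerivAt.fderiv <|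
    ((hu.differentiable (by simp)) (t, y)).hasFDerivAt.comp y (hasFDerivAt_prodMk_right t y)

lemma SmoothST.Dt_eq {u : ℝ → E' n → F} (hu : SmoothST u) (t : ℝ) (y : E' n) :
    Dt u t y = fderiv ℝ (fun p : ℝ × E' n => u p.1 p.2) (t, y) (1, 0) := by
  have h := (((hu.differentiable (by simp)) (t, y)).hasFDerivAt.comp t
    (hasFDerivAt_prodMk_left t y)).hasDerivAt
  exact h.deriv.trans (by simp)

lemma SmoothST.contDiff_fderiv {u : ℝ → E' n → F} (hu : SmoothST u) :
    ContDiff ℝ (⊤ : ℕ∞) (fderiv ℝ fun p : ℝ × E' n => u p.1 p.2) :=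
  ContDiff.fderiv_right hu (by simp)

lemma SmoothST.continuous_fderiv {u : ℝ → E' n → F} (hu : SmoothST u) :
    Continuous fun p : ℝ × E' n => fderiv ℝ (u p.1) p.2 := by
  simp_rw [hu.fderiv_eq]
  exact hu.contDiff_fderiv.continuous.clm_comp continuous_const

lemma SmoothST.smoothST_Dt {u : ℝ → E' n → F} (hu : SmoothST u) : SmoothST (Dt u) := by
  unfold SmoothST
  simp_rw [hu.Dt_eq]
  exact hu.contDiff_fderiv.clm_apply contDiff_const

lemma SmoothST.hasDerivAt_fderiv {u : ℝ → E' n → F} (hu : SmoothST u) (t : ℝ) (y : E' n) :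
    HasDerivAt (fun s => fderiv ℝ (u s) y) (fderiv ℝ (Dt u t) y) t := by
  set U : ℝ × E' n → F := fun p => u p.1 p.2
  have hdiff : HasFDerivAt (fderiv ℝ U) (fderiv ℝ (fderiv ℝ U) (t, y)) (t, y) :=
    ((hu.contDiff_fderiv.differentiable (by simp)) (t, y)).hasFDerivAt
  have hsymm : IsSymmSndFDerivAt ℝ U (t, y) :=
    (ContDiff.contDiffAt hu).isSymmSndFDerivAt (by
      rw [minSmoothness_of_isRCLikeNormedField]
      exact WithTop.coe_le_coe.2 (le_top : (2 : ℕ∞) ≤ ⊤))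
  have ht : HasDerivAt (fun s => fderiv ℝ U (s, y)) (fderiv ℝ (fderiv ℝ U) (t, y) (1, 0)) t := by
    exact (hdiff.comp t (hasFDerivAt_prodMk_left t y)).hasDerivAt.congr_deriv (by simp)
  have hDt : fderiv ℝ (Dt u t) y =
      (fderiv ℝ (fderiv ℝ U) (t, y) (1, 0)).comp (ContinuousLinearMap.inr ℝ ℝ (E' n)) := by
    have h : Dt u t = fun z => fderiv ℝ U (t, z) (1, 0) := funext fun z => hu.Dt_eq t z
    rw [h]
    have h2 := (hdiff.comp y (hasFDerivAt_prodMk_right t y)).clm_apply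
      (hasFDerivAt_const ((1 : ℝ), (0 : E' n)) y)
    refine (HasFDerivAt.fderiv h2).trans ?_
    ext v
    simpa using hsymm (0, v) (1, 0)
  rw [hDt]
  simp_rw [hu.fderiv_eq]
  exact ht.clm_comp (hasDerivAt_const t _) |>.congr_deriv (by simp)

lemma isCompact_Ball : IsCompact (Ball n) := isCompact_closedBall _ _

lemma ckNorm_one_nonneg (u : E' n → F) : 0 ≤ ckNorm 1 u :=
  Finset.sum_nonneg fun _ _ => Real.iSup_nonneg fun _ => Real.iSup_nonneg fun _ => norm_nonneg _

lemma SmoothST.exists_norm_le {u : ℝ → E' n → F} (hu : SmoothST u) (T : ℝ) :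
    ∃ C, 0 ≤ C ∧ ∀ t ∈ Icc (0 : ℝ) T, ∀ y ∈ Ball n, ∀ j ∈ Finset.range 2,
      ‖iteratedFDeriv ℝ j (u t) y‖ ≤ C := by
  have hK : IsCompact (Icc (0 : ℝ) T ×ˢ Ball n) := isCompact_Icc.prod isCompact_Ball
  obtain ⟨C₀, h₀⟩ := hK.exists_bound_of_continuousOn (ContDiff.continuous hu).continuousOn
  obtain ⟨C₁, h₁⟩ := hK.exists_bound_of_continuousOn hu.continuous_fderiv.continuousOn
  refine ⟨max 0 (max C₀ C₁), le_max_left _ _, fun t ht y hy j hj => ?_⟩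
  have hj' : j = 0 ∨ j = 1 := by simp at hj; omega
  obtain rfl | rfl := hj'
  · rw [norm_iteratedFDeriv_zero]
    exact (h₀ (t, y) ⟨ht, hy⟩).trans (by simp)
  · rw [norm_iteratedFDeriv_one]
    exact (h₁ (t, y) ⟨ht, hy⟩).trans (by simp)

lemma SmoothST.norm_fderiv_le {u : ℝ → E' n → F} (hu : SmoothST u) {T t : ℝ}
    (ht : t ∈ Icc (0 : ℝ) T) {y : E' n} (hy : y ∈ Ball n) :
    ‖fderiv ℝ (u t) y‖ ≤ ⨆ s ∈ Icc (0 : ℝ) T, ckNorm 1 (u s) := by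
  obtain ⟨C, hC, hbound⟩ := hu.exists_norm_le T
  have hck : ‖fderiv ℝ (u t) y‖ ≤ ckNorm 1 (u t) := by
    rw [← norm_iteratedFDeriv_one]
    refine le_trans (le_biSup_of_nonneg (fun _ => norm_nonneg _) ⟨C, ?_⟩ hy)
      (Finset.single_le_sum (f := fun j => ⨆ y ∈ Ball n, ‖iteratedFDeriv ℝ j (u t) y‖)
        (fun j _ => Real.iSup_nonneg fun _ => Real.iSup_nonneg fun _ => norm_nonneg _)
        (show 1 ∈ Finset.range 2 by simp))
    rintro _ ⟨z, hz, rfl⟩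
    exact hbound t ht z hz 1 (by simp)
  refine hck.trans (le_biSup_of_nonneg (fun s => ckNorm_one_nonneg (u s)) ⟨2 * C, ?_⟩ ht)
  rintro _ ⟨s, hs, rfl⟩
  calc ckNorm 1 (u s) ≤ ∑ _j ∈ Finset.range 2, C :=
        Finset.sum_le_sum fun j hj => biSup_le_of_nonneg hC fun z hz => hbound s hs z hz j hj
    _ = 2 * C := by simp

lemma SmoothST.norm_fderiv_sub_le {u : ℝ → E' n → F} (hu : SmoothST u) {T t : ℝ}
    (ht : t ∈ Icc (0 : ℝ) T) {y : E' n} (hy : y ∈ Ball n) :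
    ‖fderiv ℝ (u t) y - fderiv ℝ (u 0) y‖ ≤ T * ⨆ s ∈ Icc (0 : ℝ) T, ckNorm 1 (Dt u s) := by
  have h := norm_image_sub_le_of_norm_deriv_le_segment'
    (fun s _ => (hu.hasDerivAt_fderiv s y).hasDerivWithinAt)
    (fun s hs => hu.smoothST_Dt.norm_fderiv_le (Ico_subset_Icc_self hs) hy) t ht
  refine h.trans ?_
  rw [sub_zero, mul_comm]
  exact mul_le_mul_of_nonneg_right ht.2
    (Real.iSup_nonneg fun s => Real.iSup_nonneg fun _ => ckNorm_one_nonneg (Dt u s))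

end TimeDerivative

section Persistence

open scoped Matrix.Norms.L2Operator

/-- The gradient `(∂u/∂y^a)_a`. -/
def gradVec (u : E' n → ℝ) (y : E' n) : Fin n → ℝ := fun a => pd a u y

lemma clm_apply_eq_sum (L : E' n →L[ℝ] F) (v : E' n) :
    L v = ∑ a, v a • L (EuclideanSpace.single a 1) := by
  conv_lhs => rw [← (EuclideanSpace.basisFun (Fin n) ℝ).sum_repr v]
  simp

lemma jacM_eq {x : E' n → E' n} {y : E' n} (hx : DifferentiableAt ℝ x y) (i a : Fin n) :
    jacM x y i a = fderiv ℝ x y (EuclideanSpace.single a 1) i := by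
  have h := ((EuclideanSpace.proj i : E' n →L[ℝ] ℝ).hasFDerivAt.comp y hx.hasFDerivAt).fderiv
  exact congrArg (fun L : E' n →L[ℝ] ℝ => L (EuclideanSpace.single a 1)) h

lemma jacM_mulVec {x : E' n → E' n} {y : E' n} (hx : DifferentiableAt ℝ x y) (v : E' n) :
    WithLp.toLp 2 (jacM x y *ᵥ v.ofLp) = fderiv ℝ x y v := by
  rw [clm_apply_eq_sum]
  ext i
  simp [Matrix.mulVec, dotProduct, jacM_eq hx, mul_comm]

lemma norm_jacM_sub_le {x z : E' n → E' n} {y : E' n} (hx : DifferentiableAt ℝ x y)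
    (hz : DifferentiableAt ℝ z y) :
    ‖jacM x y - jacM z y‖ ≤ ‖fderiv ℝ x y - fderiv ℝ z y‖ := by
  refine norm_le_of_norm_mulVec_le _ (norm_nonneg _) fun v => ?_
  rw [Matrix.sub_mulVec, WithLp.toLp_sub, jacM_mulVec hx, jacM_mulVec hz]
  exact (fderiv ℝ x y - fderiv ℝ z y).le_opNorm v

lemma norm_gradVec_sub_le (p q : E' n → ℝ) (y : E' n) :
    ‖WithLp.toLp 2 (gradVec p y) - WithLp.toLp 2 (gradVec q y)‖ ≤
      ‖fderiv ℝ p y - fderiv ℝ q y‖ := by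
  set w : E' n := WithLp.toLp 2 (gradVec p y) - WithLp.toLp 2 (gradVec q y)
  have h : (fderiv ℝ p y - fderiv ℝ q y) w = ‖w‖ ^ 2 := by
    rw [clm_apply_eq_sum, EuclideanSpace.norm_sq_eq]
    refine Finset.sum_congr rfl fun a _ => ?_
    simp [w, gradVec, pd, sq]
  have h2 := (fderiv ℝ p y - fderiv ℝ q y).le_opNorm w
  rw [h, norm_pow, norm_norm] at h2
  rcases eq_or_lt_of_le (norm_nonneg w) with h0 | h0
  · rw [← h0]; exact norm_nonneg _
  · nlinarith

lemma exists_gradVec_eq_smul {p : E' n → ℝ} {y : E' n} (hp : ContDiffAt ℝ 1 p y)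
    (hy : y ∈ Sphere' n) (hp0 : ∀ z ∈ Sphere' n, p z = 0) :
    ∃ c : ℝ, gradVec p y = c • y.ofLp := by
  have hy1 : ‖y‖ = 1 := by simpa [Sphere'] using hy
  have hext : IsLocalExtrOn p {z | ‖z‖ ^ 2 = ‖y‖ ^ 2} y := by
    refine Or.inl ?_
    filter_upwards [self_mem_nhdsWithin] with z hz
    have hz1 : ‖z‖ = 1 := by
      have h : ‖z‖ ^ 2 = 1 := by simpa [hy1] using hz
      exact (pow_eq_one_iff_of_nonneg (norm_nonneg z) two_ne_zero).1 h
    rw [hp0 y hy, hp0 z (by simpa [Sphere'] using hz1)]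
  obtain ⟨a, b, hab, h⟩ := hext.exists_multipliers_of_hasStrictFDerivAt_1d
    (hasStrictFDerivAt_norm_sq y) (hp.hasStrictFDerivAt one_ne_zero)
  have hb : b ≠ 0 := by
    rintro rfl
    have h2 := congrArg (fun L : E' n →L[ℝ] ℝ => L y) h
    simp [hy1] at h2
    simp [h2] at hab
  refine ⟨-(2 * a / b), funext fun i => ?_⟩
  have h2 := congrArg (fun L : E' n →L[ℝ] ℝ => L (EuclideanSpace.single i 1)) h
  simp [EuclideanSpace.inner_single_right] at h2
  simp only [gradVec, pd, Pi.smul_apply, smul_eq_mul]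
  field_simp
  linarith

lemma gMet_inv (x : E' n → E' n) (y : E' n) :
    (gMet x y)⁻¹ = (jacM x y)⁻¹ * (jacM x y)⁻¹ᵀ := by
  rw [gMet, Matrix.mul_inv_rev, Matrix.transpose_nonsing_inv]

lemma sum_gMet_inv (x : E' n → E' n) (y : E' n) (v w : Fin n → ℝ) :
    ∑ a, ∑ b, (gMet x y)⁻¹ a b * v a * w b =
      ((jacM x y)⁻¹ᵀ *ᵥ v) ⬝ᵥ ((jacM x y)⁻¹ᵀ *ᵥ w) := by
  have h : ∑ a, ∑ b, (gMet x y)⁻¹ a b * v a * w b = v ⬝ᵥ ((gMet x y)⁻¹ *ᵥ w) := by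
    simp only [dotProduct, Matrix.mulVec, Finset.mul_sum]
    exact Finset.sum_congr rfl fun a _ => Finset.sum_congr rfl fun b _ => by ring
  rw [h, gMet_inv, ← Matrix.mulVec_mulVec, Matrix.dotProduct_mulVec, ← Matrix.mulVec_transpose]

lemma abs_gradN {x : E' n → E' n} {p : E' n → ℝ} {y : E' n}
    (hp : ∃ c : ℝ, gradVec p y = c • y.ofLp) :
    |gradN x p y| = ‖WithLp.toLp 2 ((jacM x y)⁻¹ᵀ *ᵥ gradVec p y)‖ := by
  obtain ⟨c, hc⟩ := hp
  set r : E' n := WithLp.toLp 2 ((jacM x y)⁻¹ᵀ *ᵥ y.ofLp)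
  have hden : ∑ a, ∑ b, (gMet x y)⁻¹ a b * y a * y b = ‖r‖ ^ 2 := by
    rw [sum_gMet_inv, sq_norm_toLp]
    simp [dotProduct, sq]
  have hnum : ∑ a, ∑ b, (gMet x y)⁻¹ a b * y b * pd a p y = c * ‖r‖ ^ 2 := by
    rw [← hden, Finset.mul_sum]
    refine Finset.sum_congr rfl fun a _ => ?_
    have ha : pd a p y = c * y a := congrFun hc a
    rw [ha, Finset.mul_sum]
    exact Finset.sum_congr rfl fun b _ => by ring
  rw [gradN, hnum, hden, Real.sqrt_sq (norm_nonneg r), hc, Matrix.mulVec_smul, WithLp.toLp_smul,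
    norm_smul, Real.norm_eq_abs, sq, mul_div_assoc, mul_self_div_self, abs_mul, abs_norm]

lemma SmoothST.contDiff_slice {u : ℝ → E' n → F} (hu : SmoothST u) (t : ℝ) :
    ContDiff ℝ (⊤ : ℕ∞) (u t) :=
  ContDiff.comp (g := fun p : ℝ × E' n => u p.1 p.2) hu (contDiff_prodMk_right t)

lemma SmoothST.differentiableAt {u : ℝ → E' n → F} (hu : SmoothST u) (t : ℝ) (y : E' n) :
    DifferentiableAt ℝ (u t) y :=
  (hu.contDiff_slice t).differentiable (by simp) y

lemma SmoothST.continuous_jacM {x : ℝ → E' n → E' n} (hx : SmoothST x) (t : ℝ) :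
    Continuous (jacM (x t)) := by
  refine continuous_matrix fun i a => ?_
  simp_rw [jacM_eq (hx.differentiableAt t _)]
  have h := (hx.contDiff_slice t).continuous_fderiv (by simp)
  fun_prop

lemma SmoothST.continuousOn_jacM_inv {x : ℝ → E' n → E' n} (hx : SmoothST x) {t : ℝ}
    {s : Set (E' n)} (hs : ∀ y ∈ s, (jacM (x t) y).det ≠ 0) :
    ContinuousOn (fun y => (jacM (x t) y)⁻¹) s := by
  have hJ := hx.continuous_jacM t
  simp_rw [Matrix.inv_def, Ring.inverse_eq_inv']
  exact (hJ.matrix_det.continuousOn.inv₀ hs).smul hJ.matrix_adjugate.continuousOn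

lemma continuous_gradVec {p : E' n → ℝ} (hp : ContDiff ℝ (⊤ : ℕ∞) p) :
    Continuous (gradVec p) := by
  refine continuous_pi fun a => ?_
  have h := hp.continuous_fderiv (by simp)
  unfold gradVec pd
  fun_prop

lemma Mfun_nonneg (x : ℝ → E' n → E' n) (t : ℝ) : 0 ≤ Mfun x t :=
  Real.iSup_nonneg fun _ => Real.iSup_nonneg fun _ => Real.sqrt_nonneg _

lemma Nfun_nonneg (x : ℝ → E' n → E' n) (p : ℝ → E' n → ℝ) (t : ℝ) : 0 ≤ Nfun x p t :=
  Real.iSup_nonneg fun _ => Real.iSup_nonneg fun _ => by positivity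

lemma SmoothST.frobSq_add_inv_le_Mfun {x : ℝ → E' n → E' n} (hx : SmoothST x) {t : ℝ}
    (hdet : ∀ y ∈ Ball n, (jacM (x t) y).det ≠ 0) {y : E' n} (hy : y ∈ Ball n) :
    frobSq (jacM (x t) y) + frobSq (jacM (x t) y)⁻¹ ≤ Mfun x t ^ 2 := by
  have hfrob : Continuous (frobSq : Matrix (Fin n) (Fin n) ℝ → ℝ) := by
    unfold frobSq; fun_prop
  have hcont : ContinuousOn
      (fun y => √(frobSq (jacM (x t) y) + frobSq (jacM (x t) y)⁻¹)) (Ball n) :=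
    ((hfrob.comp (hx.continuous_jacM t)).continuousOn.add
      (hfrob.comp_continuousOn (hx.continuousOn_jacM_inv hdet))).sqrt
  have h : √(frobSq (jacM (x t) y) + frobSq (jacM (x t) y)⁻¹) ≤ Mfun x t :=
    le_biSup_of_nonneg
      (f := fun y => √(frobSq (jacM (x t) y) + frobSq (jacM (x t) y)⁻¹))
      (fun _ => Real.sqrt_nonneg _)
      (isCompact_Ball.bddAbove_image hcont) hy
  exact (Real.sqrt_le_left (Mfun_nonneg x t)).1 h

lemma Sphere'_subset_Ball : Sphere' n ⊆ Ball n := Metric.sphere_subset_closedBall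

lemma inv_abs_gradN_le_Nfun {x : ℝ → E' n → E' n} (hx : SmoothST x) {p : ℝ → E' n → ℝ}
    (hp : SmoothST p) {t : ℝ} (hdet : ∀ y ∈ Ball n, (jacM (x t) y).det ≠ 0)
    (hpar : ∀ y ∈ Sphere' n, ∃ c : ℝ, gradVec (p t) y = c • y.ofLp)
    (hpN : ∀ y ∈ Sphere' n, gradN (x t) (p t) y ≠ 0) {y : E' n} (hy : y ∈ Sphere' n) :
    |gradN (x t) (p t) y|⁻¹ ≤ Nfun x p t := by
  have hK := hx.continuousOn_jacM_inv fun y hy => hdet y (Sphere'_subset_Ball hy)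
  have hmv : Continuous fun q : Matrix (Fin n) (Fin n) ℝ × (Fin n → ℝ) =>
      ‖WithLp.toLp 2 (q.1ᵀ *ᵥ q.2)‖ := by fun_prop
  have hcont : ContinuousOn (fun y => |gradN (x t) (p t) y|) (Sphere' n) :=
    (hmv.comp_continuousOn (hK.prodMk
      (continuous_gradVec (hp.contDiff_slice t)).continuousOn)).congr
      fun y hy => abs_gradN (hpar y hy)
  exact le_biSup_of_nonneg (f := fun y => |gradN (x t) (p t) y|⁻¹) (fun _ => by positivity)
    ((isCompact_sphere 0 1).bddAbove_image
      (hcont.inv₀ fun y hy => abs_ne_zero.2 (hpN y hy))) hy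

lemma norm_jacM_sub_mul_le {x : ℝ → E' n → E' n} (hx : SmoothST x) {T t C : ℝ}
    (hT : T * (⨆ t ∈ Icc (0:ℝ) T, ckNorm 1 (Dt x t)) * Mfun x 0 ≤ C)
    (ht : t ∈ Icc (0 : ℝ) T) {y : E' n} (hy : y ∈ Ball n) :
    ‖jacM (x t) y - jacM (x 0) y‖ * Mfun x 0 ≤ C := by
  refine le_trans (mul_le_mul_of_nonneg_right ?_ (Mfun_nonneg x 0)) hT
  exact (norm_jacM_sub_le (hx.differentiableAt t y) (hx.differentiableAt 0 y)).trans
    (hx.norm_fderiv_sub_le ht hy)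

end Persistence

/-- persistence of the coordinate and physical bounds (Lemma 14.1). -/
theorem stmt16 (n : ℕ) (hn : 2 ≤ n) (T : ℝ) (hT : 0 ≤ T)
    (x : ℝ → E' n → E' n) (hx : SmoothST x)
    (hjac : ∀ t ∈ Icc (0:ℝ) T, ∀ y ∈ Ball n, (jacM (x t) y).det ≠ 0)
    (p : ℝ → E' n → ℝ) (hp : SmoothST p)
    (hpb : ∀ t ∈ Icc (0:ℝ) T, ∀ y ∈ Sphere' n, p t y = 0)
    (hpN : ∀ t ∈ Icc (0:ℝ) T, ∀ y ∈ Sphere' n, gradN (x t) (p t) y ≠ 0) :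
    (T * (⨆ t ∈ Icc (0:ℝ) T, ckNorm 1 (Dt x t)) * Mfun x 0 ≤ 1 / 8 →
      ∀ t ∈ Icc (0:ℝ) T, Mfun x t ≤ 2 * Mfun x 0) ∧
    (T * (⨆ t ∈ Icc (0:ℝ) T, ckNorm 1 (Dt x t)) * Mfun x 0 ≤ 1 / 8 →
      T * (⨆ t ∈ Icc (0:ℝ) T, ckNorm 1 (Dt p t)) * Mfun x 0 * Nfun x p 0 ≤ 1 / 8 →
      ∀ t ∈ Icc (0:ℝ) T, Nfun x p t ≤ 2 * Nfun x p 0) := by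
  have h0 : (0 : ℝ) ∈ Icc (0 : ℝ) T := ⟨le_rfl, hT⟩
  have hM0 := Mfun_nonneg x 0
  have hN0 := Nfun_nonneg x p 0
  refine ⟨fun hA t ht => ?_, fun hA hB t ht => ?_⟩
  · refine biSup_le_of_nonneg (by positivity) fun y hy => ?_
    exact (Real.sqrt_le_left (by positivity)).2 <|
      frobSq_add_inv_le hn (hjac 0 h0 y hy) (hjac t ht y hy) hM0
        (hx.frobSq_add_inv_le_Mfun (hjac 0 h0) hy) (norm_jacM_sub_mul_le hx hA ht hy)
  · have hpar : ∀ s ∈ Icc (0 : ℝ) T, ∀ y ∈ Sphere' n,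
        ∃ c : ℝ, gradVec (p s) y = c • y.ofLp := fun s hs y hy =>
      exists_gradVec_eq_smul ((hp.contDiff_slice s).contDiffAt.of_le (by simp)) hy (hpb s hs)
    refine biSup_le_of_nonneg (by positivity) fun y hy => ?_
    have hyB := Sphere'_subset_Ball hy
    have hle := norm_transpose_inv_mulVec_le (hjac 0 h0 y hyB) (hjac t ht y hyB) hM0
      (hx.frobSq_add_inv_le_Mfun (hjac 0 h0) hyB) (norm_jacM_sub_mul_le hx hA ht hyB)
      (gradVec (p 0) y) (gradVec (p t) y)
    rw [← abs_gradN (hpar 0 h0 y hy), ← abs_gradN (hpar t ht y hy)] at hle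
    have hg0 : 0 < |gradN (x 0) (p 0) y| := abs_pos.2 (hpN 0 h0 y hy)
    have hgt : 0 < |gradN (x t) (p t) y| := abs_pos.2 (hpN t ht y hy)
    have hN := inv_abs_gradN_le_Nfun hx hp (hjac 0 h0) (hpar 0 h0) (hpN 0 h0) hy
    have hdiff := (norm_gradVec_sub_le (p t) (p 0) y).trans (hp.norm_fderiv_sub_le ht hyB)
    set d := ‖WithLp.toLp 2 (gradVec (p t) y) - WithLp.toLp 2 (gradVec (p 0) y)‖
    have hd : Mfun x 0 * d ≤ |gradN (x 0) (p 0) y| / 8 := by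
      have h : Mfun x 0 * d * |gradN (x 0) (p 0) y|⁻¹ ≤ 1 / 8 := by
        refine le_trans ?_ hB
        rw [mul_comm (Mfun x 0) d]
        have hR := mul_nonneg ((norm_nonneg _).trans hdiff) hM0
        have hR := mul_nonneg ((norm_nonneg _).trans hdiff) hM0
        exact mul_le_mul (mul_le_mul_of_nonneg_right hdiff hM0) hN (by positivity) hR
      rw [← div_eq_mul_inv, div_le_iff₀ hg0] at h
      linarith
    calc |gradN (x t) (p t) y|⁻¹ ≤ (|gradN (x 0) (p 0) y| / 2)⁻¹ :=
          inv_anti₀ (by positivity) (by linarith)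
      _ = 2 * |gradN (x 0) (p 0) y|⁻¹ := by rw [inv_div, div_eq_mul_inv]
      _ ≤ 2 * Nfun x p 0 := by gcongr

end
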